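/- arXiv:math/0508449 — 2 statements merged into one kernel-verified Lean document; each statement's English description precedes it below -/
import Mathlib

section
/- If K is a linear connection on TE → E and φ is a linear horizontal r-form on TE, identified with a T*E-valued r-form on E, then the Lie derivative L[K]φ coincides with the covariant exterior differential d_K φ; in coordinates both equal (∂_μ φ_{ρλ₁…λ_r} + φ_{σλ₁…λ_r} K_μ^σ{}_ρ) ẋ^ρ d^μ ∧ d^{λ₁} ∧ … ∧ d^{λ_r}. -/
open scoped BigOperators

/-- Base coordinates of a chart of the manifold `E`. -/
abbrev Base (n : ℕ) := Fin n → ℝ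

/-- Induced coordinates `(x, ẋ)` on the tangent bundle `TE`;
also used for tangent vectors of `TE` (horizontal and vertical components). -/
abbrev TE (n : ℕ) := (Fin n → ℝ) × (Fin n → ℝ)

/-- Partial derivative `∂_i` on the base. -/
noncomputable def pdB {n : ℕ} (f : Base n → ℝ) (i : Fin n) (x : Base n) : ℝ :=
  fderiv ℝ f x (Pi.single i 1)

/-- Partial derivative `∂_i` on `TE`. -/
noncomputable def pdT {n : ℕ} (f : TE n → ℝ) (i : Fin n) (p : TE n) : ℝ :=
  fderiv ℝ f p (Pi.single i 1, 0)

/-- Fibre partial derivative `∂̇_i` on `TE`. -/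
noncomputable def vdT {n : ℕ} (f : TE n → ℝ) (i : Fin n) (p : TE n) : ℝ :=
  fderiv ℝ f p (0, Pi.single i 1)

/-- An `r`-form on `TE`, given by its value on `r`-tuples of (constant-coefficient)
tangent vectors of `TE` at each point. -/
def Form (n r : ℕ) := TE n → (Fin r → TE n) → ℝ

/-- Exterior differential in coordinates. -/
noncomputable def extd {n r : ℕ} (f : Form n r) : Form n (r+1) :=
  fun p v => ∑ i : Fin (r+1),
    (-1 : ℝ) ^ (i : ℕ) * fderiv ℝ (fun q => f q (v ∘ i.succAbove)) p (v i)

/-- Insertion operator `i(K)` of a tangent-valued 1-form `Kv` (given as a map sending a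
tangent vector of `TE` to a tangent vector of `TE`, pointwise) on forms. -/
noncomputable def insK {n : ℕ} (Kv : TE n → TE n → TE n) :
    {r : ℕ} → Form n r → Form n r
  | 0, _ => fun _ _ => 0
  | (r+1), f => fun p v =>
      ∑ j : Fin (r+1), (-1 : ℝ) ^ (j : ℕ) * f p (Fin.cons (Kv p (v j)) (v ∘ j.succAbove))

/-- The Frölicher–Nijenhuis Lie derivative `L[K] = i(K)∘d − d∘i(K)` of forms along a
tangent-valued 1-form. -/
noncomputable def lieK {n r : ℕ} (Kv : TE n → TE n → TE n) (f : Form n r) :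
    Form n (r+1) :=
  fun p v => insK Kv (extd f) p v - extd (insK Kv f) p v

/-- The tangent-valued 1-form `K = dˡ ⊗ (∂_l + K_l^m ∂̇_m)` associated with a
(possibly nonlinear) connection with Christoffel symbols `K : TE n → Fin n → Fin n → ℝ`. -/
noncomputable def horK {n : ℕ} (K : TE n → Fin n → Fin n → ℝ) : TE n → TE n → TE n :=
  fun p w => (w.1, fun b => ∑ a, w.1 a * K p a b)

/-- The Christoffel symbols `K_a^b = Γ_a^b{}_c(x) ẋ^c` of a linear connection. -/
noncomputable def linK {n : ℕ} (G : Base n → Fin n → Fin n → Fin n → ℝ) :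
    TE n → Fin n → Fin n → ℝ :=
  fun p a b => ∑ c, G p.1 a b c * p.2 c

/-- The 1-form `g♭ = g_{ab} ẋ^a d^b` on `TE`. -/
noncomputable def gflat {n : ℕ} (g : Base n → Fin n → Fin n → ℝ) : Form n 1 :=
  fun p v => ∑ a, ∑ b, g p.1 a b * p.2 a * (v 0).1 b

/-- Ordinary Lie derivative of a form on `TE` along a vector field `W` on `TE`. -/
noncomputable def lieV {n r : ℕ} (W : TE n → TE n) (f : Form n r) : Form n r :=
  fun p v => fderiv ℝ (fun q => f q v) p (W p)
    + ∑ i, f p (Function.update v i (fderiv ℝ W p (v i)))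

/-- The Liouville vector field `I = ẋ^a ∂̇_a` on `TE`. -/
def liou {n : ℕ} : TE n → TE n := fun p => (0, p.2)

/-- The linear horizontal `r`-form `φ = c_{e l₁…l_r}(x) ẋ^e d^{l₁}∧…∧d^{l_r}` on `TE`
with coefficients `c`. -/
noncomputable def linHorForm {n r : ℕ} (c : Base n → Fin n → (Fin r → Fin n) → ℝ) :
    Form n r :=
  fun p v => ∑ e, ∑ l : Fin r → Fin n,
    c p.1 e l * p.2 e * Matrix.det (Matrix.of fun i j => (v i).1 (l j))

/-- A vector field on the base manifold, in coordinates. -/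
abbrev VF (n : ℕ) := Base n → Fin n → ℝ

/-- A covector field on the base manifold, in coordinates. -/
abbrev CF (n : ℕ) := Base n → Fin n → ℝ

/-- Smoothness of a vector (or covector) field. -/
def SmoothVF {n : ℕ} (X : VF n) : Prop := ∀ b, ContDiff ℝ (⊤ : ℕ∞) (fun x => X x b)

/-- Lie bracket `[X,Y]` of vector fields. -/
noncomputable def brk {n : ℕ} (X Y : VF n) : VF n :=
  fun x b => fderiv ℝ (fun y => Y y b) x (X x) - fderiv ℝ (fun y => X y b) x (Y x)

/-- Covariant derivative `∇_X Y` of a vector field for the linear connection with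
Christoffel symbols `G` (paper's sign convention: `(∇_X Y)^b = X^a ∂_a Y^b − X^a G_a^b{}_c Y^c`). -/
noncomputable def nabV {n : ℕ} (G : Base n → Fin n → Fin n → Fin n → ℝ)
    (X Y : VF n) : VF n :=
  fun x b => fderiv ℝ (fun y => Y y b) x (X x) - ∑ a, ∑ c, X x a * G x a b c * Y x c

/-- Covariant derivative `∇_X η` of a covector field:
`(∇_X η)_e = X^a (∂_a η_e + G_a^s{}_e η_s)`. -/
noncomputable def covD {n : ℕ} (G : Base n → Fin n → Fin n → Fin n → ℝ)
    (X : VF n) (η : CF n) : CF n :=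
  fun x e => fderiv ℝ (fun y => η y e) x (X x) + ∑ a, ∑ s, X x a * G x a s e * η x s

/-- Evaluation `g(A,B)` of the metric on two vector fields. -/
noncomputable def gPair {n : ℕ} (g : Base n → Fin n → Fin n → ℝ) (A B : VF n) :
    Base n → ℝ :=
  fun x => ∑ a, ∑ b, g x a b * A x a * B x b

/-- `(∇_X g)(Y,Z) = X(g(Y,Z)) − g(∇_X Y, Z) − g(Y, ∇_X Z)`. -/
noncomputable def nabG {n : ℕ} (g : Base n → Fin n → Fin n → ℝ)
    (G : Base n → Fin n → Fin n → Fin n → ℝ) (X Y Z : VF n) : Base n → ℝ :=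
  fun x => fderiv ℝ (gPair g Y Z) x (X x)
    - gPair g (nabV G X Y) Z x - gPair g Y (nabV G X Z) x

/-- Torsion of the connection, with the paper's convention
`2 τ[K](X,Y) = ∇_Y X − ∇_X Y + [X,Y]`. -/
noncomputable def tors {n : ℕ} (G : Base n → Fin n → Fin n → Fin n → ℝ)
    (X Y : VF n) : VF n :=
  fun x b => (1/2 : ℝ) * (nabV G Y X x b - nabV G X Y x b + brk X Y x b)

/-- The musical covector field `Y♭ = g(Y,·)`. -/
noncomputable def flatV {n : ℕ} (g : Base n → Fin n → Fin n → ℝ) (Y : VF n) : CF n :=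
  fun x e => ∑ a, g x a e * Y x a

/-- The covariant exterior differential of `g` viewed as a `T*E`-valued 1-form:
`(d_K g)(X,Y)(Z) = (∇_X(Y♭) − ∇_Y(X♭) − [X,Y]♭)(Z)`. -/
noncomputable def dKg {n : ℕ} (g : Base n → Fin n → Fin n → ℝ)
    (G : Base n → Fin n → Fin n → Fin n → ℝ) (X Y Z : VF n) : Base n → ℝ :=
  fun x => ∑ e,
    (covD G X (flatV g Y) x e - covD G Y (flatV g X) x e - flatV g (brk X Y) x e) * Z x e

/-- Enumeration of `{0,…,r+1} \ {i,j}` (for `i < j`) in increasing order. -/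
def omitIdx (i j a : ℕ) : ℕ := if a < i then a else if a + 1 < j then a + 1 else a + 2

theorem omitIdx_lt' {i j a r : ℕ} (h : a < r - 1) : omitIdx i j a < r + 1 := by
  unfold omitIdx; split_ifs <;> omega

/-- Evaluation of the `T*E`-valued `r`-form with coefficients `c` on an `r`-tuple of
vector fields, as a covector field. -/
noncomputable def tval {n r : ℕ} (c : Base n → Fin n → (Fin r → Fin n) → ℝ)
    (X : Fin r → VF n) : CF n :=
  fun x e => ∑ l : Fin r → Fin n,
    c x e l * Matrix.det (Matrix.of fun i j => X i x (l j))

/-- The covariant exterior differential `d_K φ` of the `T*E`-valued `r`-form `φ`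
with coefficients `c`, evaluated on `r+1` vector fields:
`d_Kφ(X₁,…,X_{r+1})(Y) = Σ_i (−1)^{i+1} ∇_{X_i}(φ(X₁,…,X̂_i,…,X_{r+1}))(Y)
 + Σ_{i<j} (−1)^{i+j} φ([X_i,X_j],X₁,…,X̂_i,…,X̂_j,…,X_{r+1})(Y)`. -/
noncomputable def covExtD {n r : ℕ} (G : Base n → Fin n → Fin n → Fin n → ℝ)
    (c : Base n → Fin n → (Fin r → Fin n) → ℝ) (X : Fin (r+1) → VF n) : CF n :=
  fun x e =>
    (∑ i : Fin (r+1), (-1 : ℝ) ^ (i : ℕ) * covD G (X i) (tval c (X ∘ i.succAbove)) x e)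
    + ∑ i : Fin (r+1), ∑ j : Fin (r+1),
        if h : (i : ℕ) < (j : ℕ) then
          (-1 : ℝ) ^ ((i : ℕ) + (j : ℕ)) *
            tval c
              ((Fin.cons (brk (X i) (X j))
                  (fun k : Fin (r-1) => X ⟨omitIdx i j k, omitIdx_lt' k.isLt⟩)) ∘
                Fin.cast (by have := j.isLt; omega : r = r - 1 + 1)) x e
        else 0

/-- The coefficients `∂_m φ_{e l₁…l_r} + φ_{s l₁…l_r} G_m^s{}_e` of both `L[K]φ` and
`d_K φ`. -/
noncomputable def cLK {n r : ℕ} (c : Base n → Fin n → (Fin r → Fin n) → ℝ)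
    (G : Base n → Fin n → Fin n → Fin n → ℝ) :
    Base n → Fin n → (Fin (r+1) → Fin n) → ℝ :=
  fun x e m => pdB (fun y => c y e (m ∘ Fin.succ)) (m 0) x
    + ∑ s, c x s (m ∘ Fin.succ) * G x (m 0) s e

/-- The elementary form `d^{l₁}∧…∧d^{l_r}` as a continuous alternating map. -/
noncomputable def detForm {n r : ℕ} (l : Fin r → Fin n) : (Base n) [⋀^Fin r]→L[ℝ] ℝ :=
  { toMultilinearMap := ((Matrix.detRowAlternating (n := Fin r) (R := ℝ)).compLinearMap
      (LinearMap.pi fun j => LinearMap.proj (l j) : (Fin n → ℝ) →ₗ[ℝ] (Fin r → ℝ))).toMultilinearMap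
    cont := by
      change Continuous fun v : Fin r → Base n => Matrix.det (Matrix.of fun i j => v i (l j))
      apply Continuous.matrix_det
      fun_prop
    map_eq_zero_of_eq' := ((Matrix.detRowAlternating (n := Fin r) (R := ℝ)).compLinearMap
      (LinearMap.pi fun j => LinearMap.proj (l j) : (Fin n → ℝ) →ₗ[ℝ] (Fin r → ℝ))).map_eq_zero_of_eq' }

theorem detForm_apply {n r : ℕ} (l : Fin r → Fin n) (v : Fin r → Base n) :
    detForm l v = Matrix.det (Matrix.of fun i j => v i (l j)) := rfl

theorem sum_cons_det {n r : ℕ} (F : Fin n → (Fin r → Fin n) → ℝ) (w : Fin (r+1) → Fin n → ℝ) :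
    ∑ m : Fin (r+1) → Fin n, F (m 0) (m ∘ Fin.succ) * Matrix.det (Matrix.of fun i j => w i (m j))
    = ∑ i : Fin (r+1), (-1 : ℝ) ^ (i : ℕ) * ∑ l : Fin r → Fin n, (∑ a, w i a * F a l) *
        Matrix.det (Matrix.of fun k j => w (i.succAbove k) (l j)) := by
  rw [← (Fin.consEquiv (fun _ : Fin (r+1) => Fin n)).sum_comp]
  rw [Fintype.sum_prod_type]
  have key : ∀ (a : Fin n) (l : Fin r → Fin n),
      F ((Fin.consEquiv (fun _ : Fin (r+1) => Fin n)) (a, l) 0)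
        ((Fin.consEquiv (fun _ : Fin (r+1) => Fin n)) (a, l) ∘ Fin.succ) *
        Matrix.det (Matrix.of fun i j => w i ((Fin.consEquiv (fun _ : Fin (r+1) => Fin n)) (a, l) j))
      = ∑ i : Fin (r+1), (-1 : ℝ) ^ (i : ℕ) * (w i a * F a l *
        Matrix.det (Matrix.of fun k j => w (i.succAbove k) (l j))) := by
    intro a l
    rw [Matrix.det_succ_column_zero, Finset.mul_sum]
    refine Finset.sum_congr rfl fun i _ => ?_
    have h1 : ((Fin.consEquiv (fun _ : Fin (r+1) => Fin n)) (a, l) ∘ Fin.succ) = l := by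
      ext j; simp [Fin.consEquiv]
    have h2 : ((Matrix.of fun i j => w i ((Fin.consEquiv (fun _ : Fin (r+1) => Fin n)) (a, l) j)).submatrix
      i.succAbove Fin.succ) = Matrix.of fun k j => w (i.succAbove k) (l j) := by
      ext k j; simp [Fin.consEquiv]
    rw [h1, h2]
    simp [Fin.consEquiv]
    ring
  simp only [key]
  rw [Finset.sum_comm]
  simp_rw [Finset.sum_comm (s := (Finset.univ : Finset (Fin n))) (t := (Finset.univ : Finset (Fin (r+1))))]
  rw [Finset.sum_comm]
  refine Finset.sum_congr rfl fun i _ => ?_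
  rw [Finset.mul_sum]
  refine Finset.sum_congr rfl fun l _ => ?_
  rw [Finset.sum_mul, Finset.mul_sum]

theorem fderiv_eq_sum_pdB {n : ℕ} (f : Base n → ℝ) (x u : Base n) :
    fderiv ℝ f x u = ∑ a, u a * pdB f a x := by
  conv_lhs => rw [pi_eq_sum_univ' u]
  simp [pdB]

theorem alt_cons {V : Type*} [NormedAddCommGroup V] [NormedSpace ℝ V] {s : ℕ}
    (A : V [⋀^Fin (s+1)]→L[ℝ] ℝ) (v : Fin (s+1) → V) (j : Fin (s+1)) :
    (-1 : ℝ) ^ (j : ℕ) * A (Fin.cons (v j) (v ∘ j.succAbove)) = A v := by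
  have h := A.map_insertNth j (v j) (v ∘ j.succAbove)
  have h2 : j.insertNth (v j) (v ∘ j.succAbove) = v := by
    exact Fin.insertNth_self_removeNth j v
  rw [h2] at h
  rw [h]
  simp [Matrix.vecCons]

/-- The form `φ(·)_e` on the base. -/
noncomputable def baseForm {n r : ℕ} (c : Base n → Fin n → (Fin r → Fin n) → ℝ) (e : Fin n)
    (x : Base n) : (Base n) [⋀^Fin r]→L[ℝ] ℝ := ∑ l, c x e l • detForm l

theorem tval_eq {n r : ℕ} (c : Base n → Fin n → (Fin r → Fin n) → ℝ) (X : Fin r → VF n)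
    (x : Base n) (e : Fin n) : tval c X x e = baseForm c e x (fun i => X i x) := by
  simp [tval, baseForm, ContinuousAlternatingMap.sum_apply, detForm_apply]

theorem baseForm_hasFDerivAt {n r : ℕ} (c : Base n → Fin n → (Fin r → Fin n) → ℝ)
    (hc : ∀ e l, ContDiff ℝ (⊤ : ℕ∞) (fun x => c x e l)) (e : Fin n) (x : Base n) :
    HasFDerivAt (baseForm c e) 
      (∑ l, (fderiv ℝ (fun y => c y e l) x).smulRight (detForm l)) x := by
  unfold baseForm
  refine HasFDerivAt.fun_sum fun l _ => ?_
  exact (((hc e l).differentiable (by simp)) x).hasFDerivAt.smul_const (detForm l)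

theorem extDeriv_base {n r : ℕ} (c : Base n → Fin n → (Fin r → Fin n) → ℝ)
    (hc : ∀ e l, ContDiff ℝ (⊤ : ℕ∞) (fun x => c x e l)) (e : Fin n) (x : Base n)
    (w : Fin (r+1) → Base n) :
    extDeriv (baseForm c e) x w = ∑ i : Fin (r+1), (-1 : ℝ) ^ (i : ℕ) *
      ∑ l : Fin r → Fin n, (∑ a, w i a * pdB (fun y => c y e l) a x) *
        Matrix.det (Matrix.of fun k j => w (i.succAbove k) (l j)) := by
  rw [extDeriv_apply (baseForm_hasFDerivAt c hc e x).differentiableAt]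
  refine Finset.sum_congr rfl fun i _ => ?_
  rw [fderiv_continuousAlternatingMap_apply_const_apply
    (baseForm_hasFDerivAt c hc e x).differentiableAt, (baseForm_hasFDerivAt c hc e x).fderiv]
  simp only [ContinuousLinearMap.sum_apply, ContinuousAlternatingMap.sum_apply,
    ContinuousLinearMap.smulRight_apply, ContinuousAlternatingMap.smul_apply, detForm_apply,
    fderiv_eq_sum_pdB, smul_eq_mul, zsmul_eq_mul]
  simp [Fin.removeNth]

theorem smoothVF_diff {n : ℕ} {X : VF n} (h : SmoothVF X) : Differentiable ℝ X :=
  differentiable_pi.2 fun b => (h b).differentiable (by simp)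

theorem brk_eq {n : ℕ} {X Y : VF n} (hX : SmoothVF X) (hY : SmoothVF Y) (x : Base n) :
    brk X Y x = VectorField.lieBracket ℝ X Y x := by
  ext b
  have h : ∀ (Z : VF n), SmoothVF Z → ∀ u : Base n,
      fderiv ℝ (fun y => Z y b) x u = fderiv ℝ Z x u b := by
    intro Z hZ u
    have h1 : HasFDerivAt (fun y => Z y b) _ x :=
      hasFDerivAt_pi'.1 (smoothVF_diff hZ x).hasFDerivAt b
    rw [h1.fderiv]
    rfl
  simp only [brk, VectorField.lieBracket, h X hX, h Y hY]
  rfl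

theorem sum_tri {m : ℕ} (g : Fin (m+2) → Fin (m+2) → ℝ) :
    (∑ i : Fin (m+2), ∑ j : Fin (m+2), if (i : ℕ) < (j : ℕ) then g i j else 0)
    = ∑ i : Fin (m+1), ∑ j ≥ i, g i.castSucc j.succ := by
  rw [Fin.sum_univ_castSucc]
  have : (∑ j : Fin (m+2), if ((Fin.last (m+1) : Fin (m+2)) : ℕ) < (j : ℕ) then
      g (Fin.last (m+1)) j else 0) = 0 := by
    refine Finset.sum_eq_zero fun j _ => ?_
    rw [if_neg]; simp; omega
  rw [this, add_zero]
  refine Finset.sum_congr rfl fun i _ => ?_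
  rw [Fin.sum_univ_succ]
  simp only [Fin.val_castSucc, Fin.val_zero, Nat.not_lt_zero, if_false, zero_add, Fin.val_succ]
  rw [← Finset.sum_filter]
  refine Finset.sum_congr ?_ fun _ _ => rfl
  ext j
  simp only [Finset.mem_filter, Finset.mem_univ, true_and, Finset.mem_Ici, Fin.le_def, Nat.lt_succ_iff]

/-- The bracket part of `covExtD`. -/
noncomputable def brkPart {n r : ℕ}
    (c : Base n → Fin n → (Fin r → Fin n) → ℝ) (X : Fin (r+1) → VF n) : CF n :=
  fun x e => ∑ i : Fin (r+1), ∑ j : Fin (r+1),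
        if h : (i : ℕ) < (j : ℕ) then
          (-1 : ℝ) ^ ((i : ℕ) + (j : ℕ)) *
            tval c
              ((Fin.cons (brk (X i) (X j))
                  (fun k : Fin (r-1) => X ⟨omitIdx i j k, omitIdx_lt' k.isLt⟩)) ∘
                Fin.cast (by have := j.isLt; omega : r = r - 1 + 1)) x e
        else 0

theorem extDeriv_vf {n r : ℕ} (c : Base n → Fin n → (Fin r → Fin n) → ℝ)
    (hc : ∀ e l, ContDiff ℝ (⊤ : ℕ∞) (fun x => c x e l)) (e : Fin n) (x : Base n)
    (X : Fin (r+1) → VF n) (hX : ∀ i, SmoothVF (X i)) :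
    extDeriv (baseForm c e) x (fun i => X i x) =
      (∑ i : Fin (r+1), (-1 : ℝ) ^ (i : ℕ) *
        fderiv ℝ (fun y => tval c (X ∘ i.succAbove) y e) x (X i x)) + brkPart c X x e := by
  cases r with
  | zero =>
    rw [extDeriv_apply_vectorField_of_pairwise_commute
      (baseForm_hasFDerivAt c hc e x).differentiableAt (fun i => smoothVF_diff (hX i) x)]
    · simp [brkPart, tval_eq, Function.comp_def]
      rfl
    · intro i j hij
      exact absurd (Subsingleton.elim (α := Fin 1) i j) hij
  | succ m =>
    rw [extDeriv_apply_vectorField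
      (baseForm_hasFDerivAt c hc e x).differentiableAt (fun i => smoothVF_diff (hX i) x)]
    rw [sub_eq_add_neg]
    congr 1
    · refine Finset.sum_congr rfl fun i _ => ?_
      simp [tval_eq, Function.comp_def]
      rfl
    · unfold brkPart
      have := sum_tri (m := m) (fun i j => (-1 : ℝ) ^ ((i : ℕ) + (j : ℕ)) *
            tval c
              (Fin.cons (brk (X i) (X j))
                  (fun k : Fin m => X ⟨omitIdx i j k, omitIdx_lt' (r := m+1) k.isLt⟩)) x e)
      refine Eq.trans (Eq.trans ?_ this.symm) (Finset.sum_congr rfl fun i _ =>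
        Finset.sum_congr rfl fun j _ => ?_)
      swap
      · split_ifs <;> rfl
      rw [← Finset.sum_neg_distrib]
      refine Finset.sum_congr rfl fun i _ => ?_
      rw [← Finset.sum_neg_distrib]
      refine Finset.sum_congr rfl fun j hj => ?_
      have hij : (i : ℕ) ≤ j := Fin.le_def.1 (Finset.mem_Ici.1 hj)
      rw [tval_eq, ← brk_eq (hX _) (hX _)]
      have : (Matrix.vecCons (brk (X i.castSucc) (X j.succ) x)
          (j.removeNth (i.castSucc.removeNth fun k => X k x)) : Fin (m+1) → Base n) =
        fun k : Fin (m+1) => (Fin.cons (brk (X i.castSucc) (X j.succ))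
                  (fun k : Fin m => X ⟨omitIdx (i.castSucc : Fin (m+2)) (j.succ : Fin (m+2)) k,
                    omitIdx_lt' (r := m+1) k.isLt⟩) : Fin (m+1) → VF n) k x := by
        funext k
        refine Fin.cases ?_ (fun k => ?_) k
        · rfl
        · simp only [Matrix.cons_val_succ, Fin.cons_succ, Fin.removeNth]
          congr 1
          congr 1
          ext
          simp only [omitIdx, Fin.succAbove, Fin.lt_def, Fin.val_castSucc, Fin.val_succ]
          split_ifs <;> simp_all <;> omega
      rw [this]
      simp [pow_add, pow_succ]

theorem part2 {n r : ℕ} (c : Base n → Fin n → (Fin r → Fin n) → ℝ)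
    (G : Base n → Fin n → Fin n → Fin n → ℝ)
    (hc : ∀ e l, ContDiff ℝ (⊤ : ℕ∞) (fun x => c x e l))
    (X : Fin (r+1) → VF n) (hX : ∀ i, SmoothVF (X i)) (x : Base n) (e : Fin n) :
    covExtD G c X x e = tval (cLK c G) X x e := by
  have h1 : covExtD G c X x e = (∑ i : Fin (r+1), (-1 : ℝ) ^ (i : ℕ) *
      covD G (X i) (tval c (X ∘ i.succAbove)) x e) + brkPart c X x e := rfl
  have h2 := extDeriv_vf c hc e x X hX
  rw [extDeriv_base c hc e x] at h2
  have h3 := sum_cons_det (fun a l => pdB (fun y => c y e l) a x + ∑ s, c x s l * G x a s e)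
    (fun i => X i x)
  have h4 : tval (cLK c G) X x e = _ := h3
  rw [h4, h1]
  simp only [covD, mul_add, Finset.sum_add_distrib, add_mul]
  rw [h2]
  rw [add_right_comm]
  congr 1
  refine Finset.sum_congr rfl fun i _ => ?_
  congr 1
  simp only [tval, Finset.mul_sum, Finset.sum_mul]
  conv_rhs => rw [Finset.sum_comm]
  refine Finset.sum_congr rfl fun a _ => ?_
  conv_rhs => rw [Finset.sum_comm]
  refine Finset.sum_congr rfl fun s _ => Finset.sum_congr rfl fun l _ => ?_
  simp only [Function.comp]
  ring

/-- `φ` on `TE` as a continuous alternating map. -/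
noncomputable def teForm {n r : ℕ} (c : Base n → Fin n → (Fin r → Fin n) → ℝ)
    (p : TE n) : (TE n) [⋀^Fin r]→L[ℝ] ℝ :=
  ∑ e, ∑ l, (c p.1 e l * p.2 e) •
    (detForm l).compContinuousLinearMap (ContinuousLinearMap.fst ℝ (Base n) (Base n))

theorem teForm_apply {n r : ℕ} (c : Base n → Fin n → (Fin r → Fin n) → ℝ)
    (p : TE n) (v : Fin r → TE n) : linHorForm c p v = teForm c p v := by
  simp [teForm, linHorForm, ContinuousAlternatingMap.sum_apply, detForm_apply]

theorem coef_hasFDerivAt {n r : ℕ} (c : Base n → Fin n → (Fin r → Fin n) → ℝ)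
    (hc : ∀ e l, ContDiff ℝ (⊤ : ℕ∞) (fun x => c x e l)) (e : Fin n) (l : Fin r → Fin n)
    (p : TE n) :
    HasFDerivAt (fun p : TE n => c p.1 e l * p.2 e)
      (c p.1 e l • ((ContinuousLinearMap.proj e : Base n →L[ℝ] ℝ).comp
          (ContinuousLinearMap.snd ℝ (Base n) (Base n)))
       + p.2 e • (fderiv ℝ (fun y => c y e l) p.1).comp
          (ContinuousLinearMap.fst ℝ (Base n) (Base n))) p := by
  have h1 : HasFDerivAt (fun p : TE n => c p.1 e l) ((fderiv ℝ (fun y => c y e l) p.1).comp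
          (ContinuousLinearMap.fst ℝ (Base n) (Base n))) p :=
    HasFDerivAt.comp (g := fun y => c y e l) p
      (((hc e l).differentiable (by simp)) p.1).hasFDerivAt hasFDerivAt_fst
  have h2 : HasFDerivAt (fun p : TE n => p.2 e) ((ContinuousLinearMap.proj e : Base n →L[ℝ] ℝ).comp
          (ContinuousLinearMap.snd ℝ (Base n) (Base n))) p :=
    ((ContinuousLinearMap.proj e : Base n →L[ℝ] ℝ).comp
          (ContinuousLinearMap.snd ℝ (Base n) (Base n))).hasFDerivAt
  exact h1.mul h2

theorem teForm_diff {n r : ℕ} (c : Base n → Fin n → (Fin r → Fin n) → ℝ)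
    (hc : ∀ e l, ContDiff ℝ (⊤ : ℕ∞) (fun x => c x e l)) (p : TE n) :
    DifferentiableAt ℝ (teForm c) p := by
  unfold teForm
  refine DifferentiableAt.fun_sum fun e _ => DifferentiableAt.fun_sum fun l _ => ?_
  exact (coef_hasFDerivAt c hc e l p).differentiableAt.smul_const _

theorem fderiv_lin {n r : ℕ} (c : Base n → Fin n → (Fin r → Fin n) → ℝ)
    (hc : ∀ e l, ContDiff ℝ (⊤ : ℕ∞) (fun x => c x e l)) (p : TE n) (w : Fin r → TE n)
    (u : TE n) :
    fderiv ℝ (fun q => linHorForm c q w) p u = ∑ e, ∑ l : Fin r → Fin n,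
      (c p.1 e l * u.2 e + p.2 e * ∑ a, u.1 a * pdB (fun y => c y e l) a p.1) *
       Matrix.det (Matrix.of fun i j => (w i).1 (l j)) := by
  unfold linHorForm
  have := HasFDerivAt.fun_sum (u := Finset.univ) fun e _ =>
    HasFDerivAt.fun_sum (u := Finset.univ) fun (l : Fin r → Fin n) _ => 
    (coef_hasFDerivAt c hc e l p).mul_const (Matrix.det (Matrix.of fun i j => (w i).1 (l j)))
  rw [this.fderiv]
  simp [fderiv_eq_sum_pdB, mul_comm, add_mul]

theorem extd_eq {n r : ℕ} (c : Base n → Fin n → (Fin r → Fin n) → ℝ)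
    (hc : ∀ e l, ContDiff ℝ (⊤ : ℕ∞) (fun x => c x e l)) (p : TE n) (v : Fin (r+1) → TE n) :
    extd (linHorForm c) p v = extDeriv (teForm c) p v := by
  rw [extDeriv_apply (teForm_diff c hc p)]
  unfold extd
  refine Finset.sum_congr rfl fun i _ => ?_
  simp only [teForm_apply]
  simp
  rfl

theorem lin_congr {n r : ℕ} (c : Base n → Fin n → (Fin r → Fin n) → ℝ)
    (p : TE n) (v w : Fin r → TE n) (h : ∀ i, (v i).1 = (w i).1) :
    linHorForm c p v = linHorForm c p w := by
  simp [linHorForm, h]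

theorem insK_lin {n r : ℕ} (c : Base n → Fin n → (Fin r → Fin n) → ℝ)
    (K : TE n → Fin n → Fin n → ℝ) (p : TE n) (v : Fin r → TE n) :
    insK (horK K) (linHorForm c) p v = r * linHorForm c p v := by
  cases r with
  | zero => simp [insK]
  | succ r =>
    simp only [insK]
    have : ∀ j : Fin (r+1), (-1 : ℝ) ^ (j : ℕ) *
        linHorForm c p (Fin.cons (horK K p (v j)) (v ∘ j.succAbove)) = linHorForm c p v := by
      intro j
      rw [lin_congr c p _ (Fin.cons (v j) (v ∘ j.succAbove))]
      · rw [teForm_apply, teForm_apply, alt_cons]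
      · intro i
        refine Fin.cases ?_ (fun k => ?_) i <;> simp [horK]
    simp [this]

theorem extd_cons {n r : ℕ} (c : Base n → Fin n → (Fin r → Fin n) → ℝ)
    (p a b : TE n) (w : Fin r → TE n) (h : a.1 = b.1) :
    extd (linHorForm c) p (Fin.cons a w) = extd (linHorForm c) p (Fin.cons b w) +
      (fderiv ℝ (fun q => linHorForm c q w) p a - fderiv ℝ (fun q => linHorForm c q w) p b) := by
  unfold extd
  rw [Fin.sum_univ_succ, Fin.sum_univ_succ]
  have h0 : ∀ a : TE n, (Fin.cons a w : Fin (r+1) → TE n) ∘ (0 : Fin (r+1)).succAbove = w := by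
    intro a; ext k <;> simp
  simp only [h0, Fin.cons_zero, Fin.cons_succ]
  have : ∀ i : Fin r, (fun q => linHorForm c q ((Fin.cons a w : Fin (r+1) → TE n) ∘ i.succ.succAbove))
      = (fun q => linHorForm c q ((Fin.cons b w : Fin (r+1) → TE n) ∘ i.succ.succAbove)) := by
    intro i
    funext q
    apply lin_congr
    intro k
    simp only [Function.comp]
    refine Fin.cases (motive := fun m => ((Fin.cons a w : Fin (r+1) → TE n) m).1 = ((Fin.cons b w : Fin (r+1) → TE n) m).1) ?_ (fun k => ?_) (i.succ.succAbove k) <;> simp [h]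
  simp only [this]
  simp
  ring

theorem lieK_lin {n r : ℕ} (c : Base n → Fin n → (Fin r → Fin n) → ℝ)
    (hc : ∀ e l, ContDiff ℝ (⊤ : ℕ∞) (fun x => c x e l))
    (K : TE n → Fin n → Fin n → ℝ) (p : TE n) (v : Fin (r+1) → TE n) :
    lieK (horK K) (linHorForm c) p v = ∑ j : Fin (r+1), (-1 : ℝ) ^ (j : ℕ) *
      fderiv ℝ (fun q => linHorForm c q (v ∘ j.succAbove)) p (horK K p (v j)) := by
  have h1 : extd (insK (horK K) (linHorForm c)) p v = r * extd (linHorForm c) p v := by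
    simp only [extd, insK_lin]
    rw [Finset.mul_sum]
    refine Finset.sum_congr rfl fun i _ => ?_
    have hd : DifferentiableAt ℝ (fun q => linHorForm c q (v ∘ i.succAbove)) p := by
      unfold linHorForm
      refine DifferentiableAt.fun_sum fun e _ => DifferentiableAt.fun_sum fun l _ => ?_
      exact (coef_hasFDerivAt c hc e l p).differentiableAt.mul_const _
    rw [fderiv_const_mul hd]
    simp
    ring
  have h2 : insK (horK K) (extd (linHorForm c)) p v = (r + 1) * extd (linHorForm c) p v +
     (∑ j : Fin (r+1), (-1 : ℝ) ^ (j : ℕ) *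
      fderiv ℝ (fun q => linHorForm c q (v ∘ j.succAbove)) p (horK K p (v j))
      - extd (linHorForm c) p v) := by
    simp only [insK]
    have : ∀ j : Fin (r+1), (-1 : ℝ) ^ (j : ℕ) * extd (linHorForm c) p
        (Fin.cons (horK K p (v j)) (v ∘ j.succAbove)) = extd (linHorForm c) p v +
        ((-1 : ℝ) ^ (j : ℕ) *
      fderiv ℝ (fun q => linHorForm c q (v ∘ j.succAbove)) p (horK K p (v j)) -
      (-1 : ℝ) ^ (j : ℕ) *
      fderiv ℝ (fun q => linHorForm c q (v ∘ j.succAbove)) p (v j)) := by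
      intro j
      rw [extd_cons c p (horK K p (v j)) (v j) _ rfl, mul_add, mul_sub]
      congr 1
      rw [extd_eq c hc, extd_eq c hc, alt_cons]
    simp only [this, Finset.sum_add_distrib, Finset.sum_sub_distrib]
    rw [show (∑ j : Fin (r+1), (-1 : ℝ) ^ (j : ℕ) *
      fderiv ℝ (fun q => linHorForm c q (v ∘ j.succAbove)) p (v j)) = extd (linHorForm c) p v from rfl]
    simp
  unfold lieK
  rw [h1, h2]
  ring

theorem part1 {n r : ℕ} (c : Base n → Fin n → (Fin r → Fin n) → ℝ)
    (G : Base n → Fin n → Fin n → Fin n → ℝ)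
    (hc : ∀ e l, ContDiff ℝ (⊤ : ℕ∞) (fun x => c x e l)) (p : TE n) (v : Fin (r+1) → TE n) :
    lieK (horK (linK G)) (linHorForm c) p v = linHorForm (cLK c G) p v := by
  rw [lieK_lin c hc]
  have h3 : linHorForm (cLK c G) p v = ∑ e, ∑ m : Fin (r+1) → Fin n,
     ((pdB (fun y => c y e (m ∘ Fin.succ)) (m 0) p.1
       + ∑ s, c p.1 s (m ∘ Fin.succ) * G p.1 (m 0) s e) * p.2 e) *
       Matrix.det (Matrix.of fun i j => (v i).1 (m j)) := rfl
  have h4 := fun e => sum_cons_det (fun a l => (pdB (fun y => c y e l) a p.1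
       + ∑ s, c p.1 s l * G p.1 a s e) * p.2 e) (fun i => (v i).1)
  simp only [h3, h4]
  rw [Finset.sum_comm]
  refine Finset.sum_congr rfl fun i _ => ?_
  rw [← Finset.mul_sum, fderiv_lin c hc]
  congr 1
  rw [Finset.sum_comm]
  conv_rhs => rw [Finset.sum_comm]
  refine Finset.sum_congr rfl fun l _ => ?_
  rw [← Finset.sum_mul, ← Finset.sum_mul]
  congr 1
  simp only [horK, linK, Finset.sum_add_distrib, add_mul, mul_add]
  rw [add_comm]
  congr 1
  · refine Finset.sum_congr rfl fun e _ => ?_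
    rw [Finset.mul_sum]
    refine Finset.sum_congr rfl fun a _ => ?_
    ring
  · simp only [Finset.mul_sum, Finset.sum_mul]
    refine Eq.trans (Finset.sum_congr rfl fun e _ => Finset.sum_comm) ?_
    rw [Finset.sum_comm]
    refine Finset.sum_congr rfl fun d _ => ?_
    rw [Finset.sum_comm]
    refine Finset.sum_congr rfl fun a _ => Finset.sum_congr rfl fun e _ => ?_
    ring

/-- If `K` is a linear connection on `TE → E` (Christoffel symbols
`G_m^s{}_e(x)`) and `φ` is a linear horizontal `r`-form on `TE` (coefficients `c`),
identified with a `T*E`-valued `r`-form on `E`, then the Lie derivative `L[K]φ`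
coincides with the covariant exterior differential `d_K φ`; in coordinates both equal
`(∂_m φ_{e l₁…l_r} + φ_{s l₁…l_r} K_m^s{}_e) ẋ^e d^m ∧ d^{l₁} ∧ … ∧ d^{l_r}`. -/
theorem stmt2 (n r : ℕ) (c : Base n → Fin n → (Fin r → Fin n) → ℝ)
    (G : Base n → Fin n → Fin n → Fin n → ℝ)
    (hc : ∀ e l, ContDiff ℝ (⊤ : ℕ∞) (fun x => c x e l))
    (hG : ∀ a b d, ContDiff ℝ (⊤ : ℕ∞) (fun x => G x a b d)) :
    (∀ p v, lieK (horK (linK G)) (linHorForm c) p v = linHorForm (cLK c G) p v)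
    ∧ (∀ X : Fin (r+1) → VF n, (∀ i, SmoothVF (X i)) →
        ∀ x e, covExtD G c X x e = tval (cLK c G) X x e) := by
    exact ⟨fun p v => part1 c G hc p v, fun X hX x e => part2 c G hc X hX x e⟩
end

section
/- Let K be a torsion-free linear connection on a manifold E and g a pseudo-Riemannian metric. Then the following are equivalent: (1) ∇g is a totally symmetric (0,3)-tensor field; (2) the 2-form Υ[g,K] on TE is closed; (3) the Schouten bracket [Λ[g,K], Λ[g,K]] vanishes. -/
open scoped BigOperators

/-- The 2-form `Υ[g,K] = g_{ab}(ḋ^a − K_c^a d^c) ∧ d^b` on `TE`. -/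
noncomputable def UpsG {n : ℕ} (g : Base n → Fin n → Fin n → ℝ)
    (K : TE n → Fin n → Fin n → ℝ) : Form n 2 :=
  fun p v => ∑ a, ∑ b, g p.1 a b *
    (((v 0).2 a - ∑ c, K p c a * (v 0).1 c) * (v 1).1 b
      - ((v 1).2 a - ∑ c, K p c a * (v 1).1 c) * (v 0).1 b)

/-- The curvature components `R[K]_{ab}^e = −2(∂_a K_b^e + K_a^s ∂̇_s K_b^e)`. -/
noncomputable def RawR {n : ℕ} (K : TE n → Fin n → Fin n → ℝ)
    (p : TE n) (a b e : Fin n) : ℝ :=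
  -2 * (pdT (fun q => K q b e) a p + ∑ s, K p a s * vdT (fun q => K q b e) s p)

/-- The lowered curvature components `R[K]_{abe} = g_{ce} R[K]_{ab}^c`. -/
noncomputable def Rlow {n : ℕ} (g : Base n → Fin n → Fin n → ℝ)
    (K : TE n → Fin n → Fin n → ℝ) (p : TE n) (a b e : Fin n) : ℝ :=
  ∑ c, g p.1 c e * RawR K p a b c

/-- Index set for the coordinates `(x^a, ẋ^a)` of `TE`. -/
abbrev Idx (n : ℕ) := Fin n ⊕ Fin n

/-- Coordinate derivative on `TE` in the direction labelled by `A : Idx n`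
(`∂_a` for `inl a`, `∂̇_a` for `inr a`). -/
noncomputable def DT {n : ℕ} (A : Idx n) (f : TE n → ℝ) (p : TE n) : ℝ :=
  match A with
  | .inl a => pdT f a p
  | .inr a => vdT f a p

/-- Components of the horizontal vector field `∂_a + K_a^c ∂̇_c` on `TE`. -/
def Xcomp {n : ℕ} (K : TE n → Fin n → Fin n → ℝ) (p : TE n) (a : Fin n) :
    Idx n → ℝ :=
  fun A => match A with
  | .inl c => if c = a then 1 else 0
  | .inr c => K p a c

/-- Components of the vertical vector field `∂̇_b` on `TE`. -/
def Ycomp {n : ℕ} (b : Fin n) : Idx n → ℝ :=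
  fun A => match A with
  | .inl _ => 0
  | .inr c => if c = b then 1 else 0

/-- Components of the 2-vector `Λ[g,K] = g^{ab}(∂_a + K_a^c ∂̇_c) ∧ ∂̇_b` on `TE`. -/
noncomputable def Lam {n : ℕ} (ginv : Base n → Fin n → Fin n → ℝ)
    (K : TE n → Fin n → Fin n → ℝ) (p : TE n) (A B : Idx n) : ℝ :=
  ∑ a, ∑ b, ginv p.1 a b * (Xcomp K p a A * Ycomp b B - Xcomp K p a B * Ycomp b A)

/-- Components of the Schouten–Nijenhuis bracket `[L,L]` of a 2-vector `L` on `TE`: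
`[L,L]^{ABC} = 2 Σ_D (L^{DA} ∂_D L^{BC} + L^{DB} ∂_D L^{CA} + L^{DC} ∂_D L^{AB})`. -/
noncomputable def SB {n : ℕ} (L : TE n → Idx n → Idx n → ℝ)
    (p : TE n) (A B C : Idx n) : ℝ :=
  2 * ∑ D : Idx n,
    (L p D A * DT D (fun q => L q B C) p
      + L p D B * DT D (fun q => L q C A) p
      + L p D C * DT D (fun q => L q A B) p)

/-- The raised curvature components `R[K]^{abe} = g^{ac} g^{bs} R[K]_{cs}^e`. -/
noncomputable def Rup {n : ℕ} (ginv : Base n → Fin n → Fin n → ℝ)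
    (K : TE n → Fin n → Fin n → ℝ) (p : TE n) (a b e : Fin n) : ℝ :=
  ∑ c, ∑ s, ginv p.1 a c * ginv p.1 b s * RawR K p c s e

namespace Aux15

lemma alg_main {ι : Type*} [Fintype ι] [DecidableEq ι] (W L : Matrix ι ι ℝ)
    (dW dL : ι → Matrix ι ι ℝ) (h1 : W * L = 1) (hL : ∀ A B, L A B = - L B A)
    (hd : ∀ D, dW D * L + W * dL D = 0) (A B C : ι) :
    ∑ D, (L D A * dL D B C + L D B * dL D C A + L D C * dL D A B)
      = - ∑ D, ∑ P, ∑ Q, L A D * L B P * L C Q * (dW D P Q + dW P Q D + dW Q D P) := by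
  have h2 : L * W = 1 := mul_eq_one_comm.mp h1
  have h3 : ∀ D, dL D = - (L * dW D * L) := by
    intro D
    have := congrArg (fun M => L * M) (hd D)
    simp only [Matrix.mul_add, ← Matrix.mul_assoc, h2, Matrix.one_mul, Matrix.mul_zero] at this
    exact eq_neg_of_add_eq_zero_right this
  have h4 : ∀ D X Y Z, L D X * dL D Y Z = - ∑ P, ∑ Q, L X D * L Y P * L Z Q * dW D P Q := by
    intro D X Y Z
    rw [h3, Matrix.neg_apply, Matrix.mul_apply]
    simp only [Matrix.mul_apply, Finset.sum_mul]
    rw [Finset.sum_comm, mul_neg, Finset.mul_sum]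
    congr 1
    refine Finset.sum_congr rfl fun P _ => ?_
    rw [Finset.mul_sum]
    refine Finset.sum_congr rfl fun Q _ => ?_
    rw [hL D X, hL Q Z]; ring
  simp only [h4, mul_add, Finset.sum_add_distrib, Finset.sum_neg_distrib, neg_add]
  congr 1
  · congr 1
    congr 1
    calc _ = ∑ P, ∑ Q, ∑ D, L B P * L C Q * L A D * dW P Q D := rfl
         _ = ∑ P, ∑ D, ∑ Q, L B P * L C Q * L A D * dW P Q D :=
            Finset.sum_congr rfl fun P _ => Finset.sum_comm
         _ = ∑ D, ∑ P, ∑ Q, L B P * L C Q * L A D * dW P Q D := Finset.sum_comm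
         _ = _ := by
            refine Finset.sum_congr rfl fun D _ => Finset.sum_congr rfl fun P _ =>
              Finset.sum_congr rfl fun Q _ => ?_
            ring
  · congr 1
    calc _ = ∑ D, ∑ Q, ∑ P, L C Q * L A D * L B P * dW Q D P := Finset.sum_comm
         _ = ∑ D, ∑ P, ∑ Q, L C Q * L A D * L B P * dW Q D P :=
            Finset.sum_congr rfl fun P _ => Finset.sum_comm
         _ = _ := by
            refine Finset.sum_congr rfl fun D _ => Finset.sum_congr rfl fun P _ =>
              Finset.sum_congr rfl fun Q _ => ?_
            ring

lemma tri_zero {ι : Type*} [Fintype ι] [DecidableEq ι] (W L : Matrix ι ι ℝ) (h1 : W * L = 1)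
    (T : ι → ι → ι → ℝ)
    (h : ∀ A B C, ∑ D, ∑ P, ∑ Q, L A D * L B P * L C Q * T D P Q = 0) (A B C : ι) :
    T A B C = 0 := by
  have key : ∀ (S : ι → ℝ), (∀ A, ∑ D, L A D * S D = 0) → ∀ A, S A = 0 := by
    intro S hS A
    have h0 : L.mulVec S = 0 := funext hS
    have : (W * L).mulVec S = 0 := by rw [← Matrix.mulVec_mulVec, h0, Matrix.mulVec_zero]
    rw [h1, Matrix.one_mulVec] at this
    exact congrFun this A
  have s1 : ∀ B C D, ∑ P, ∑ Q, L B P * L C Q * T D P Q = 0 := by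
    intro B C
    apply key
    intro A
    rw [← h A B C]
    simp only [Finset.mul_sum, mul_assoc]
  have s2 : ∀ C D P, ∑ Q, L C Q * T D P Q = 0 := by
    intro C D
    apply key
    intro B
    rw [← s1 B C D]
    simp only [Finset.mul_sum, mul_assoc]
  exact key (fun Q => T A B Q) (fun C => s2 C A B) C

variable {n : ℕ}

lemma two_le_top : (2 : WithTop ℕ∞) ≤ ((⊤ : ℕ∞) : WithTop ℕ∞) :=
  WithTop.coe_le_coe.2 (le_top : (2 : ℕ∞) ≤ ⊤)

/-- basis vectors -/
noncomputable def eD : Idx n → TE n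
  | .inl a => (Pi.single a 1, 0)
  | .inr a => (0, Pi.single a 1)

/-- coordinates -/
def cmp (v : TE n) : Idx n → ℝ
  | .inl a => v.1 a
  | .inr a => v.2 a

lemma DT_eq (A : Idx n) (f : TE n → ℝ) (p : TE n) : DT A f p = fderiv ℝ f p (eD A) := by
  cases A <;> rfl

lemma decomp (v : TE n) : v = ∑ D, cmp v D • eD D := by
  rw [Fintype.sum_sum_type]
  ext i <;> simp [cmp, eD, Prod.fst_sum, Prod.snd_sum, Finset.sum_apply, Pi.single_apply]

lemma fd_eq (f : TE n → ℝ) (p v : TE n) : fderiv ℝ f p v = ∑ D, cmp v D * DT D f p := by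
  conv_lhs => rw [decomp v]
  simp [map_sum, DT_eq]

lemma cmp_eD (A B : Idx n) : cmp (eD A) B = if A = B then 1 else 0 := by
  cases A <;> cases B <;> simp [cmp, eD, Pi.single_apply, eq_comm]

/-- components of Upsilon -/
noncomputable def Wm (g : Base n → Fin n → Fin n → ℝ) (K : TE n → Fin n → Fin n → ℝ)
    (p : TE n) : Idx n → Idx n → ℝ
  | .inl c, .inl b => (∑ a, g p.1 a c * K p b a) - ∑ a, g p.1 a b * K p c a
  | .inl b, .inr a => - g p.1 a b
  | .inr a, .inl b => g p.1 a b
  | .inr _, .inr _ => 0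

lemma Ups_eq (g : Base n → Fin n → Fin n → ℝ) (K : TE n → Fin n → Fin n → ℝ) (p : TE n)
    (v : Fin 2 → TE n) :
    UpsG g K p v = ∑ P, ∑ Q, cmp (v 0) P * cmp (v 1) Q * Wm g K p P Q := by
  simp only [Fintype.sum_sum_type, cmp, Wm, UpsG]
  simp only [mul_sub, sub_mul, Finset.sum_sub_distrib, Finset.sum_add_distrib, Finset.mul_sum,
    Finset.sum_mul, mul_zero, mul_neg, Finset.sum_neg_distrib, Finset.sum_const_zero, add_zero]
  have e1 : ∀ u w : Fin n → ℝ, ∑ a, ∑ b, ∑ c, g p.1 a b * (K p c a * u c * w b)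
      = ∑ c, ∑ b, ∑ a, u c * w b * (g p.1 a b * K p c a) := by
    intro u w
    rw [Finset.sum_comm]
    calc _ = ∑ b, ∑ c, ∑ a, g p.1 a b * (K p c a * u c * w b) :=
            Finset.sum_congr rfl fun _ _ => Finset.sum_comm
      _ = ∑ c, ∑ b, ∑ a, g p.1 a b * (K p c a * u c * w b) := Finset.sum_comm
      _ = _ := Finset.sum_congr rfl fun _ _ => Finset.sum_congr rfl fun _ _ =>
          Finset.sum_congr rfl fun _ _ => by ring
  rw [e1, e1]
  have e2 : ∑ c, ∑ b, ∑ a, (v 0).1 c * (v 1).1 b * (g p.1 a c * K p b a)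
      = ∑ c, ∑ b, ∑ a, (v 1).1 c * (v 0).1 b * (g p.1 a b * K p c a) := by
    rw [Finset.sum_comm]
    exact Finset.sum_congr rfl fun _ _ => Finset.sum_congr rfl fun _ _ =>
          Finset.sum_congr rfl fun _ _ => by ring
  have e3 : ∑ c, ∑ b, (v 0).1 c * (v 1).2 b * g p.1 b c
      = ∑ a, ∑ b, g p.1 a b * ((v 1).2 a * (v 0).1 b) := by
    rw [Finset.sum_comm]
    exact Finset.sum_congr rfl fun _ _ => Finset.sum_congr rfl fun _ _ => by ring
  have e4 : ∑ c, ∑ b, (v 0).2 c * (v 1).1 b * g p.1 c b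
      = ∑ a, ∑ b, g p.1 a b * ((v 0).2 a * (v 1).1 b) := by
    exact Finset.sum_congr rfl fun _ _ => Finset.sum_congr rfl fun _ _ => by ring
  rw [e2, e3, e4]
  ring

lemma Lam_eq (g : Base n → Fin n → Fin n → ℝ) (K : TE n → Fin n → Fin n → ℝ) (p : TE n)
    (A B : Idx n) : Lam g K p A B = match A, B with
      | .inl _, .inl _ => 0
      | .inl a, .inr b => g p.1 a b
      | .inr b, .inl a => - g p.1 a b
      | .inr c, .inr d => (∑ a, g p.1 a d * K p a c) - ∑ a, g p.1 a c * K p a d := by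
  cases A <;> cases B <;> simp [Lam, Xcomp, Ycomp, mul_sub, Finset.sum_sub_distrib]

lemma Lam_anti (g : Base n → Fin n → Fin n → ℝ) (K : TE n → Fin n → Fin n → ℝ) (p : TE n)
    (A B : Idx n) : Lam g K p A B = - Lam g K p B A := by
  cases A <;> cases B <;> simp [Lam_eq]

lemma WL (g ginv : Base n → Fin n → Fin n → ℝ) (K : TE n → Fin n → Fin n → ℝ) (p : TE n)
    (hinv : ∀ x a b, ∑ c, ginv x a c * g x c b = if a = b then (1:ℝ) else 0)
    (hinv' : ∀ x a b, ∑ c, g x a c * ginv x c b = if a = b then (1:ℝ) else 0) :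
    (Matrix.of (Wm g K p)) * (Matrix.of (Lam ginv K p)) = 1 := by
  ext A B
  rw [Matrix.mul_apply]
  simp only [Fintype.sum_sum_type, Matrix.of_apply]
  rcases A with c | a <;> rcases B with b | d
  · simp only [Lam_eq, Wm]
    simp [Matrix.one_apply, mul_comm (g _ _ _), hinv, eq_comm]
  · simp only [Lam_eq, Wm]
    simp only [mul_sub, sub_mul, Finset.sum_sub_distrib, Finset.mul_sum, Finset.sum_mul, neg_mul,
      Finset.sum_neg_distrib]
    have e1 : ∑ x, ∑ a, g p.1 a x * K p c a * ginv p.1 x d = K p c d := by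
      rw [Finset.sum_comm]
      calc _ = ∑ a, K p c a * ∑ x, g p.1 a x * ginv p.1 x d := by
            refine Finset.sum_congr rfl fun _ _ => ?_
            rw [Finset.mul_sum]
            exact Finset.sum_congr rfl fun _ _ => by ring
        _ = _ := by simp [hinv']
    have e2 : ∑ x, ∑ a, g p.1 x c * (ginv p.1 a x * K p a d) = K p c d := by
      rw [Finset.sum_comm]
      calc _ = ∑ a, K p a d * ∑ x, ginv p.1 a x * g p.1 x c := by
            refine Finset.sum_congr rfl fun _ _ => ?_
            rw [Finset.mul_sum]
            exact Finset.sum_congr rfl fun _ _ => by ring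
        _ = _ := by simp [hinv]
    have e3 : ∑ x, ∑ a, g p.1 a c * K p x a * ginv p.1 x d
        = ∑ x, ∑ a, g p.1 x c * (ginv p.1 a d * K p a x) := by
      rw [Finset.sum_comm]
      exact Finset.sum_congr rfl fun _ _ => Finset.sum_congr rfl fun _ _ => by ring
    rw [e1, e2, e3]
    simp
  · simp [Lam_eq, Wm]
  · simp only [Lam_eq, Wm]
    simp [Matrix.one_apply, hinv']

/-- components of dUpsilon -/
noncomputable def TT (g : Base n → Fin n → Fin n → ℝ) (K : TE n → Fin n → Fin n → ℝ) (p : TE n)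
    (D P Q : Idx n) : ℝ :=
  DT D (fun q => Wm g K q P Q) p + DT P (fun q => Wm g K q Q D) p + DT Q (fun q => Wm g K q D P) p

lemma Wm_anti (g : Base n → Fin n → Fin n → ℝ) (K : TE n → Fin n → Fin n → ℝ) (p : TE n)
    (A B : Idx n) : Wm g K p A B = - Wm g K p B A := by
  cases A <;> cases B <;> simp [Wm]

lemma diff1 {f : Base n → ℝ} (hf : ContDiff ℝ (⊤ : ℕ∞) f) :
    Differentiable ℝ (fun q : TE n => f q.1) :=
  (hf.differentiable (by simp)).comp differentiable_fst

lemma diffK {G : Base n → Fin n → Fin n → Fin n → ℝ}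
    (hG : ∀ a b d, ContDiff ℝ (⊤ : ℕ∞) (fun x => G x a b d)) (a b : Fin n) :
    Differentiable ℝ (fun q => linK G q a b) := by
  unfold linK
  have h0 : ∀ c, Differentiable ℝ (fun x => G x a b c) := fun c =>
    (hG a b c).differentiable (by simp)
  have h1 : ∀ c, Differentiable ℝ (fun q : TE n => G q.1 a b c) := fun c => diff1 (hG a b c)
  fun_prop

lemma diffW {g : Base n → Fin n → Fin n → ℝ} {G : Base n → Fin n → Fin n → Fin n → ℝ}
    (hg : ∀ a b, ContDiff ℝ (⊤ : ℕ∞) (fun x => g x a b))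
    (hG : ∀ a b d, ContDiff ℝ (⊤ : ℕ∞) (fun x => G x a b d)) (P Q : Idx n) :
    Differentiable ℝ (fun q => Wm g (linK G) q P Q) := by
  have h0 : ∀ a b, Differentiable ℝ (fun x => g x a b) := fun a b =>
    (hg a b).differentiable (by simp)
  have h1 : ∀ a b, Differentiable ℝ (fun q : TE n => g q.1 a b) := fun a b => diff1 (hg a b)
  have h2 : ∀ a b, Differentiable ℝ (fun q : TE n => linK G q a b) := fun a b => diffK hG a b
  cases P <;> cases Q <;> simp only [Wm] <;> fun_prop

lemma diffL {g : Base n → Fin n → Fin n → ℝ} {G : Base n → Fin n → Fin n → Fin n → ℝ}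
    (hg : ∀ a b, ContDiff ℝ (⊤ : ℕ∞) (fun x => g x a b))
    (hG : ∀ a b d, ContDiff ℝ (⊤ : ℕ∞) (fun x => G x a b d)) (P Q : Idx n) :
    Differentiable ℝ (fun q => Lam g (linK G) q P Q) := by
  have h0 : ∀ a b, Differentiable ℝ (fun x => g x a b) := fun a b =>
    (hg a b).differentiable (by simp)
  have h1 : ∀ a b, Differentiable ℝ (fun q : TE n => g q.1 a b) := fun a b => diff1 (hg a b)
  have h2 : ∀ a b, Differentiable ℝ (fun q : TE n => linK G q a b) := fun a b => diffK hG a b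
  cases P <;> cases Q <;> simp only [Lam_eq] <;> fun_prop

lemma DT_neg (D : Idx n) (f : TE n → ℝ) (p : TE n) : DT D (fun q => - f q) p = - DT D f p := by
  simp [DT_eq]

lemma DT_sum {ι : Type*} [Fintype ι] (D : Idx n) (f : ι → TE n → ℝ)
    (hf : ∀ i, Differentiable ℝ (f i)) (p : TE n) :
    DT D (fun q => ∑ i, f i q) p = ∑ i, DT D (f i) p := by
  simp only [DT_eq]
  rw [fderiv_fun_sum (fun i _ => (hf i) p)]
  simp

lemma DT_mul (D : Idx n) (f h : TE n → ℝ)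
    (hf : Differentiable ℝ f) (hh : Differentiable ℝ h) (p : TE n) :
    DT D (fun q => f q * h q) p = DT D f p * h p + f p * DT D h p := by
  simp only [DT_eq]
  rw [fderiv_fun_mul (hf p) (hh p)]
  simp; ring

lemma DT_sub (D : Idx n) (f h : TE n → ℝ)
    (hf : Differentiable ℝ f) (hh : Differentiable ℝ h) (p : TE n) :
    DT D (fun q => f q - h q) p = DT D f p - DT D h p := by
  simp only [DT_eq]
  rw [fderiv_fun_sub (hf p) (hh p)]
  simp

lemma DT_const (D : Idx n) (c : ℝ) (p : TE n) : DT D (fun _ => c) p = 0 := by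
  simp [DT_eq]

lemma fderiv_fst {f : Base n → ℝ} (hf : Differentiable ℝ f) (p v : TE n) :
    fderiv ℝ (fun q : TE n => f q.1) p v = fderiv ℝ f p.1 v.1 := by
  have h : HasFDerivAt (fun q : TE n => f q.1)
      ((fderiv ℝ f p.1).comp (ContinuousLinearMap.fst ℝ _ _)) p :=
    (hf p.1).hasFDerivAt.comp p hasFDerivAt_fst
  rw [h.fderiv]; rfl

lemma DT_inl {f : Base n → ℝ} (hf : Differentiable ℝ f) (a : Fin n) (p : TE n) :
    DT (.inl a) (fun q : TE n => f q.1) p = pdB f a p.1 := by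
  rw [DT_eq, fderiv_fst hf]; rfl

lemma DT_inr {f : Base n → ℝ} (hf : Differentiable ℝ f) (a : Fin n) (p : TE n) :
    DT (.inr a) (fun q : TE n => f q.1) p = 0 := by
  rw [DT_eq, fderiv_fst hf]; simp [eD]

lemma DT_vel (D : Idx n) (c : Fin n) (p : TE n) :
    DT D (fun q : TE n => q.2 c) p = if D = .inr c then 1 else 0 := by
  have h : HasFDerivAt (fun q : TE n => q.2 c)
      ((ContinuousLinearMap.proj (R := ℝ) (φ := fun _ : Fin n => ℝ) c).comp
        (ContinuousLinearMap.snd ℝ _ _)) p :=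
    ((ContinuousLinearMap.proj (R := ℝ) (φ := fun _ : Fin n => ℝ) c).comp
        (ContinuousLinearMap.snd ℝ (Fin n → ℝ) (Fin n → ℝ))).hasFDerivAt
  rw [DT_eq, h.fderiv]
  cases D <;> simp [eD, Pi.single_apply, eq_comm]

lemma ext_eq {g : Base n → Fin n → Fin n → ℝ} {G : Base n → Fin n → Fin n → Fin n → ℝ}
    (hg : ∀ a b, ContDiff ℝ (⊤ : ℕ∞) (fun x => g x a b))
    (hG : ∀ a b d, ContDiff ℝ (⊤ : ℕ∞) (fun x => G x a b d)) (p : TE n) (v : Fin 3 → TE n) :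
    extd (UpsG g (linK G)) p v
      = ∑ D, ∑ P, ∑ Q, cmp (v 0) D * cmp (v 1) P * cmp (v 2) Q * TT g (linK G) p D P Q := by
  have hW := diffW hg hG
  have hfd : ∀ (u w z : TE n), fderiv ℝ (fun q => ∑ P, ∑ Q, cmp u P * cmp w Q
        * Wm g (linK G) q P Q) p z
      = ∑ D, ∑ P, ∑ Q, cmp z D * cmp u P * cmp w Q * DT D (fun q => Wm g (linK G) q P Q) p := by
    intro u w z
    rw [fd_eq]
    refine Finset.sum_congr rfl fun D _ => ?_
    rw [DT_sum _ _ (fun P => by fun_prop), Finset.mul_sum]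
    refine Finset.sum_congr rfl fun P _ => ?_
    rw [DT_sum _ _ (fun P => by fun_prop), Finset.mul_sum]
    refine Finset.sum_congr rfl fun Q _ => ?_
    rw [DT_mul _ _ _ (by fun_prop) (hW P Q), DT_const]
    ring
  simp only [extd, Ups_eq, Function.comp]
  refine (Fin.sum_univ_three _).trans ?_
  rw [hfd, hfd, hfd]
  have i1 : (0 : Fin 3).succAbove (0 : Fin 2) = 1 := rfl
  have i2 : (0 : Fin 3).succAbove (1 : Fin 2) = 2 := rfl
  have i3 : (1 : Fin 3).succAbove (0 : Fin 2) = 0 := rfl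
  have i4 : (1 : Fin 3).succAbove (1 : Fin 2) = 2 := rfl
  have i5 : (2 : Fin 3).succAbove (0 : Fin 2) = 0 := rfl
  have i6 : (2 : Fin 3).succAbove (1 : Fin 2) = 1 := rfl
  rw [i1, i2, i3, i4, i5, i6]
  simp only [TT, mul_add, Finset.sum_add_distrib]
  have e1 : ∑ D, ∑ P, ∑ Q, cmp (v 0) D * cmp (v 1) P * cmp (v 2) Q *
        DT P (fun q => Wm g (linK G) q Q D) p
      = - ∑ D, ∑ P, ∑ Q, cmp (v 1) D * cmp (v 0) P * cmp (v 2) Q *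
        DT D (fun q => Wm g (linK G) q P Q) p := by
    rw [Finset.sum_comm]
    simp only [← Finset.sum_neg_distrib]
    refine Finset.sum_congr rfl fun D _ => Finset.sum_congr rfl fun P _ =>
              Finset.sum_congr rfl fun Q _ => ?_
    have : (fun q => Wm g (linK G) q Q P) = fun q => - Wm g (linK G) q P Q :=
      funext fun q => Wm_anti _ _ _ _ _
    rw [this, DT_neg]; ring
  have e2 : ∑ D, ∑ P, ∑ Q, cmp (v 0) D * cmp (v 1) P * cmp (v 2) Q *
        DT Q (fun q => Wm g (linK G) q D P) p
      = ∑ D, ∑ P, ∑ Q, cmp (v 2) D * cmp (v 0) P * cmp (v 1) Q *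
        DT D (fun q => Wm g (linK G) q P Q) p := by
    symm
    calc _ = ∑ P, ∑ D, ∑ Q, cmp (v 2) D * cmp (v 0) P * cmp (v 1) Q *
        DT D (fun q => Wm g (linK G) q P Q) p := Finset.sum_comm
      _ = ∑ P, ∑ Q, ∑ D, cmp (v 2) D * cmp (v 0) P * cmp (v 1) Q *
        DT D (fun q => Wm g (linK G) q P Q) p := Finset.sum_congr rfl fun _ _ => Finset.sum_comm
      _ = _ := Finset.sum_congr rfl fun _ _ => Finset.sum_congr rfl fun _ _ =>
              Finset.sum_congr rfl fun _ _ => by ring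
  rw [e1, e2]
  simp

lemma ext_iff {g : Base n → Fin n → Fin n → ℝ} {G : Base n → Fin n → Fin n → Fin n → ℝ}
    (hg : ∀ a b, ContDiff ℝ (⊤ : ℕ∞) (fun x => g x a b))
    (hG : ∀ a b d, ContDiff ℝ (⊤ : ℕ∞) (fun x => G x a b d)) :
    (∀ p (v : Fin 3 → TE n), extd (UpsG g (linK G)) p v = 0)
      ↔ ∀ p D P Q, TT g (linK G) p D P Q = 0 := by
  constructor
  · intro h p D P Q
    have := h p ![eD D, eD P, eD Q]
    rw [ext_eq hg hG] at this
    simpa [cmp_eD] using this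
  · intro h p v
    rw [ext_eq hg hG]
    simp [h]

lemma SB_iff {g ginv : Base n → Fin n → Fin n → ℝ} {G : Base n → Fin n → Fin n → Fin n → ℝ}
    (hg : ∀ a b, ContDiff ℝ (⊤ : ℕ∞) (fun x => g x a b))
    (hginv : ∀ a b, ContDiff ℝ (⊤ : ℕ∞) (fun x => ginv x a b))
    (hinv : ∀ x a b, ∑ c, ginv x a c * g x c b = if a = b then (1:ℝ) else 0)
    (hinv' : ∀ x a b, ∑ c, g x a c * ginv x c b = if a = b then (1:ℝ) else 0)
    (hG : ∀ a b d, ContDiff ℝ (⊤ : ℕ∞) (fun x => G x a b d)) (p : TE n) :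
    (∀ D P Q, TT g (linK G) p D P Q = 0) ↔ ∀ A B C, SB (Lam ginv (linK G)) p A B C = 0 := by
  have h1 := fun p => WL g ginv (linK G) p hinv hinv'
  have key := alg_main (Matrix.of (Wm g (linK G) p)) (Matrix.of (Lam ginv (linK G) p))
    (fun D => Matrix.of fun P Q => DT D (fun q => Wm g (linK G) q P Q) p)
    (fun D => Matrix.of fun P Q => DT D (fun q => Lam ginv (linK G) q P Q) p)
    (h1 p) (fun A B => Lam_anti _ _ _ _ _) (by
      intro D
      ext A C
      have hc : (fun q => ∑ B, Wm g (linK G) q A B * Lam ginv (linK G) q B C)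
          = fun _ => (1 : Matrix (Idx n) (Idx n) ℝ) A C := by
        funext q
        have := congrFun (congrFun (h1 q) A) C
        rw [Matrix.mul_apply] at this
        exact this
      have h2 := congrArg (fun f => DT D f p) hc
      simp only [DT_const] at h2
      rw [DT_sum D (fun B q => Wm g (linK G) q A B * Lam ginv (linK G) q B C)
        (fun B => (diffW hg hG A B).mul (diffL hginv hG B C))] at h2
      simp only [DT_mul _ _ _ (diffW hg hG _ _) (diffL hginv hG _ _),
        Finset.sum_add_distrib] at h2
      simpa [Matrix.mul_apply] using h2)
  have hSB : ∀ A B C, SB (Lam ginv (linK G)) p A B C = -2 * ∑ D, ∑ P, ∑ Q,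
      Lam ginv (linK G) p A D * Lam ginv (linK G) p B P * Lam ginv (linK G) p C Q
        * TT g (linK G) p D P Q := by
    intro A B C
    have := key A B C
    simp only [Matrix.of_apply] at this
    unfold SB TT
    rw [this]; ring
  constructor
  · intro h A B C
    rw [hSB]; simp [h]
  · intro h
    refine tri_zero _ _ (h1 p) _ fun A B C => ?_
    have := h A B C
    rw [hSB] at this
    simpa using this

/-- the antisymmetrised covariant derivative -/
noncomputable def CC (g : Base n → Fin n → Fin n → ℝ) (G : Base n → Fin n → Fin n → Fin n → ℝ)
    (x : Base n) (a b e : Fin n) : ℝ :=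
  pdB (fun y => g y b e) a x - pdB (fun y => g y a e) b x
    + (∑ s, G x a s e * g x s b) - ∑ s, G x b s e * g x s a

lemma DT_K_inr {G : Base n → Fin n → Fin n → Fin n → ℝ}
    (hG : ∀ a b d, ContDiff ℝ (⊤ : ℕ∞) (fun x => G x a b d)) (a b e : Fin n) (p : TE n) :
    DT (.inr e) (fun q => linK G q a b) p = G p.1 a b e := by
  unfold linK
  have h0 : ∀ c, Differentiable ℝ (fun x => G x a b c) := fun c =>
    (hG a b c).differentiable (by simp)
  have h1 : ∀ c, Differentiable ℝ (fun q : TE n => G q.1 a b c) := fun c => diff1 (hG a b c)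
  rw [DT_sum _ _ (fun c => by fun_prop)]
  have : ∀ c, DT (.inr e) (fun q : TE n => G q.1 a b c * q.2 c) p
      = if e = c then G p.1 a b c else 0 := by
    intro c
    rw [DT_mul _ _ _ (h1 c) (by fun_prop),
      DT_inr ((hG a b c).differentiable (by simp)), DT_vel]
    simp
  simp [this]

lemma T_rll {g : Base n → Fin n → Fin n → ℝ} {G : Base n → Fin n → Fin n → Fin n → ℝ}
    (hg : ∀ a b, ContDiff ℝ (⊤ : ℕ∞) (fun x => g x a b)) (hgsym : ∀ x a b, g x a b = g x b a)
    (hG : ∀ a b d, ContDiff ℝ (⊤ : ℕ∞) (fun x => G x a b d)) (p : TE n) (e c b : Fin n) :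
    TT g (linK G) p (.inr e) (.inl c) (.inl b) = - CC g G p.1 c b e := by
  have h0 : ∀ a b, Differentiable ℝ (fun x => g x a b) := fun a b =>
    (hg a b).differentiable (by simp)
  have h1 : ∀ a b, Differentiable ℝ (fun q : TE n => g q.1 a b) := fun a b => diff1 (hg a b)
  have h2 : ∀ a b, Differentiable ℝ (fun q : TE n => linK G q a b) := fun a b => diffK hG a b
  have hd := fun a b => (hg a b).differentiable (by simp)
  have key : ∀ b c, DT (.inr e) (fun q : TE n => ∑ a, g q.1 a c * linK G q b a) p
      = ∑ a, G p.1 b a e * g p.1 a c := by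
    intro b c
    rw [DT_sum _ _ (fun a => by fun_prop)]
    refine Finset.sum_congr rfl fun a _ => ?_
    rw [DT_mul _ _ _ (h1 a c) (h2 b a), DT_inr (hd a c), DT_K_inr hG]
    ring
  simp only [TT, Wm, DT_neg]
  rw [DT_sub _ _ _ (by fun_prop) (by fun_prop), key, key, DT_inl (hd e b), DT_inl (hd e c)]
  simp only [CC, fun x => hgsym x e]
  ring

lemma T_iff {g : Base n → Fin n → Fin n → ℝ} {G : Base n → Fin n → Fin n → Fin n → ℝ}
    (hg : ∀ a b, ContDiff ℝ (⊤ : ℕ∞) (fun x => g x a b)) (hgsym : ∀ x a b, g x a b = g x b a)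
    (hG : ∀ a b d, ContDiff ℝ (⊤ : ℕ∞) (fun x => G x a b d)) :
    (∀ p D P Q, TT g (linK G) p D P Q = 0) ↔ ∀ x a b e, CC g G x a b e = 0 := by
  constructor
  · intro h x a b e
    have := h (x, 0) (.inr e) (.inl a) (.inl b)
    rw [T_rll hg hgsym hG] at this
    simpa using this
  · intro h p
    have cyc : ∀ D P Q, TT g (linK G) p D P Q = TT g (linK G) p P Q D := by
      intro D P Q; simp only [TT]; ring
    have hd := fun a b => (hg a b).differentiable (by simp)
    have rll : ∀ e c b, TT g (linK G) p (.inr e) (.inl c) (.inl b) = 0 := by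
      intro e c b; rw [T_rll hg hgsym hG, h]; simp
    have rrl : ∀ e c b, TT g (linK G) p (.inr e) (.inr c) (.inl b) = 0 := by
      intro e c b
      simp only [TT, Wm, DT_neg, DT_const]
      rw [DT_inr (hd c b), DT_inr (hd e b)]; simp
    have rrr : ∀ e c b, TT g (linK G) p (.inr e) (.inr c) (.inr b) = 0 := by
      intro e c b
      simp only [TT, Wm, DT_const]; simp
    have hW : ∀ c b, (fun q => Wm g (linK G) q (.inl c) (.inl b))
        = fun q => ∑ e, q.2 e * (pdB (fun y => g y b e) c q.1 - pdB (fun y => g y c e) b q.1) := by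
      intro c b
      funext q
      have : ∀ e, pdB (fun y => g y b e) c q.1 - pdB (fun y => g y c e) b q.1
        = (∑ s, G q.1 b s e * g q.1 s c) - ∑ s, G q.1 c s e * g q.1 s b := by
        intro e
        have := h q.1 c b e
        unfold CC at this
        linarith
      have k : ∀ b c, ∑ a, g q.1 a c * linK G q b a = ∑ e, q.2 e * ∑ s, G q.1 b s e * g q.1 s c := by
        intro b c
        simp only [linK, Finset.mul_sum]
        rw [Finset.sum_comm]
        exact Finset.sum_congr rfl fun _ _ => Finset.sum_congr rfl fun _ _ => by ring
      simp only [Wm, this, k, mul_sub, Finset.sum_sub_distrib]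
    have hpd : ∀ a b c, ContDiff ℝ (⊤ : ℕ∞) (fun x => pdB (fun y => g y a b) c x) := by
      intro a b c
      unfold pdB
      exact ((hg a b).fderiv_right (m := (⊤ : ℕ∞)) (by simp)).clm_apply contDiff_const
    have hpdd := fun a b c => (hpd a b c).differentiable (by simp)
    have hpd1 := fun a b c => diff1 (hpd a b c)
    have hD : ∀ d c b, DT (.inl d) (fun q => Wm g (linK G) q (.inl c) (.inl b)) p
        = ∑ e, p.2 e * (pdB (fun x => pdB (fun y => g y b e) c x) d p.1
            - pdB (fun x => pdB (fun y => g y c e) b x) d p.1) := by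
      intro d c b
      rw [hW, DT_sum _ _ (fun e => by fun_prop)]
      refine Finset.sum_congr rfl fun e _ => ?_
      rw [DT_mul _ _ _ (by fun_prop) (by fun_prop), DT_sub _ _ _ (hpd1 _ _ _) (hpd1 _ _ _),
        DT_inl (hpdd _ _ _), DT_inl (hpdd _ _ _), DT_vel]
      simp
    have hsymm : ∀ a e c d, pdB (fun x => pdB (fun y => g y a e) c x) d p.1
        = pdB (fun x => pdB (fun y => g y a e) d x) c p.1 := by
      intro a e c d
      have hs : IsSymmSndFDerivAt ℝ (fun y => g y a e) p.1 :=
        ((hg a e).contDiffAt).isSymmSndFDerivAt (by simpa using two_le_top)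
      have hf : DifferentiableAt ℝ (fderiv ℝ (fun y => g y a e)) p.1 :=
        (((hg a e).fderiv_right (m := (⊤ : ℕ∞)) (by simp)).differentiable (by simp)) _
      have hh : ∀ u v : Base n, fderiv ℝ (fun x => fderiv ℝ (fun y => g y a e) x u) p.1 v
          = fderiv ℝ (fderiv ℝ (fun y => g y a e)) p.1 v u := by
        intro u v
        rw [fderiv_clm_apply hf (differentiableAt_const _)]
        simp
      unfold pdB
      rw [hh, hh]
      exact hs _ _
    have lll : ∀ e c b, TT g (linK G) p (.inl e) (.inl c) (.inl b) = 0 := by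
      intro d c b
      simp only [TT, hD, ← Finset.sum_add_distrib]
      refine Finset.sum_eq_zero fun e _ => ?_
      rw [hsymm b e c d, hsymm c e b d, hsymm d e b c]
      ring
    rintro (d | d) (a | a) (b | b)
    · exact lll _ _ _
    · rw [cyc, cyc]; exact rll _ _ _
    · rw [cyc]; exact rll _ _ _
    · rw [cyc]; exact rrl _ _ _
    · exact rll _ _ _
    · rw [cyc, cyc]; exact rrl _ _ _
    · exact rrl _ _ _
    · exact rrr _ _ _

lemma fdB (f : Base n → ℝ) (x v : Base n) : fderiv ℝ f x v = ∑ i, v i * pdB f i x := by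
  have : v = ∑ i, v i • (Pi.single i (1:ℝ) : Base n) := by
    ext j; simp [Finset.sum_apply, Pi.single_apply]
  conv_lhs => rw [this]
  simp [map_sum, pdB]

lemma nab_eq {g : Base n → Fin n → Fin n → ℝ} {G : Base n → Fin n → Fin n → Fin n → ℝ}
    (hg : ∀ a b, ContDiff ℝ (⊤ : ℕ∞) (fun x => g x a b))
    (X Y Z : VF n) (hY : SmoothVF Y) (hZ : SmoothVF Z) (x : Base n) :
    nabG g G X Y Z x = ∑ a, ∑ b, ∑ e, X x a * Y x b * Z x e *
      (pdB (fun y => g y b e) a x + (∑ s, G x a s b * g x s e) + ∑ s, G x a s e * g x b s) := by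
  have hd := fun a b => (hg a b).differentiable (by simp)
  have hYd := fun b => (hY b).differentiable (by simp)
  have hZd := fun b => (hZ b).differentiable (by simp)
  have e1 : fderiv ℝ (gPair g Y Z) x (X x) = ∑ b, ∑ e,
      ((∑ a, X x a * pdB (fun y => g y b e) a x) * Y x b * Z x e
        + g x b e * fderiv ℝ (fun y => Y y b) x (X x) * Z x e
        + g x b e * Y x b * fderiv ℝ (fun y => Z y e) x (X x)) := by
    unfold gPair
    rw [fderiv_fun_sum (fun b _ => by fun_prop), sum_apply]
    refine Finset.sum_congr rfl fun b _ => ?_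
    rw [fderiv_fun_sum (fun b _ => by fun_prop), sum_apply]
    refine Finset.sum_congr rfl fun e _ => ?_
    rw [fderiv_fun_mul (by fun_prop) (by fun_prop), fderiv_fun_mul (by fun_prop) (by fun_prop),
      ← fdB]
    simp
    ring
  unfold nabG
  rw [e1]
  simp only [gPair, nabV]
  have e2 : ∑ a, ∑ b, ∑ e, X x a * Y x b * Z x e * pdB (fun y => g y b e) a x
      = ∑ b, ∑ e, (∑ a, X x a * pdB (fun y => g y b e) a x) * Y x b * Z x e := by
    simp only [Finset.sum_mul]
    rw [Finset.sum_comm]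
    refine Finset.sum_congr rfl fun b _ => ?_
    rw [Finset.sum_comm]
    exact Finset.sum_congr rfl fun _ _ => Finset.sum_congr rfl fun _ _ => by ring
  have e3 : ∑ a, ∑ b, ∑ e, X x a * Y x b * Z x e * ∑ s, G x a s b * g x s e
      = ∑ s, ∑ e, g x s e * (∑ a, ∑ c, X x a * G x a s c * Y x c) * Z x e := by
    simp only [Finset.mul_sum, Finset.sum_mul, ← Fintype.sum_prod_type']
    refine Fintype.sum_equiv ⟨fun t : Fin n × Fin n × Fin n × Fin n =>
        (t.2.2.2, t.2.2.1, t.1, t.2.1),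
      fun t : Fin n × Fin n × Fin n × Fin n => (t.2.2.1, t.2.2.2, t.2.1, t.1), fun _ => rfl, fun _ => rfl⟩ _ _ fun t => ?_
    simp only [Equiv.coe_fn_mk]
    ring
  have e4 : ∑ a, ∑ b, ∑ e, X x a * Y x b * Z x e * ∑ s, G x a s e * g x b s
      = ∑ b, ∑ s, g x b s * Y x b * (∑ a, ∑ c, X x a * G x a s c * Z x c) := by
    simp only [Finset.mul_sum, ← Fintype.sum_prod_type']
    refine Fintype.sum_equiv ⟨fun t : Fin n × Fin n × Fin n × Fin n =>
        (t.2.1, t.2.2.2, t.1, t.2.2.1),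
      fun t : Fin n × Fin n × Fin n × Fin n => (t.2.2.1, t.1, t.2.2.2, t.2.1), fun _ => rfl, fun _ => rfl⟩ _ _ fun t => ?_
    simp only [Equiv.coe_fn_mk]
    ring
  simp only [mul_add, mul_sub, sub_mul, Finset.sum_add_distrib, Finset.sum_sub_distrib]
  rw [e2, e3, e4]
  ring

lemma nab_sub {g : Base n → Fin n → Fin n → ℝ} {G : Base n → Fin n → Fin n → Fin n → ℝ}
    (hg : ∀ a b, ContDiff ℝ (⊤ : ℕ∞) (fun x => g x a b)) (hgsym : ∀ x a b, g x a b = g x b a)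
    (htf : ∀ x a b d, G x a b d = G x d b a)
    (X Y Z : VF n) (hX : SmoothVF X) (hY : SmoothVF Y) (hZ : SmoothVF Z) (x : Base n) :
    nabG g G X Y Z x - nabG g G Y X Z x
      = ∑ a, ∑ b, ∑ e, X x a * Y x b * Z x e * CC g G x a b e := by
  rw [nab_eq hg X Y Z hY hZ, nab_eq hg Y X Z hX hZ]
  rw [Finset.sum_comm (f := fun a b => ∑ e, Y x a * X x b * Z x e *
      (pdB (fun y => g y b e) a x + (∑ s, G x a s b * g x s e) + ∑ s, G x a s e * g x b s))]
  simp only [← Finset.sum_sub_distrib]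
  refine Finset.sum_congr rfl fun a _ => Finset.sum_congr rfl fun b _ =>
    Finset.sum_congr rfl fun e _ => ?_
  have h1 : ∑ s, G x b s a * g x s e = ∑ s, G x a s b * g x s e :=
    Finset.sum_congr rfl fun s _ => by rw [htf x b s a]
  rw [h1]
  simp only [CC, hgsym x a, hgsym x b]
  ring

lemma nab_iff {g : Base n → Fin n → Fin n → ℝ} {G : Base n → Fin n → Fin n → Fin n → ℝ}
    (hg : ∀ a b, ContDiff ℝ (⊤ : ℕ∞) (fun x => g x a b)) (hgsym : ∀ x a b, g x a b = g x b a)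
    (htf : ∀ x a b d, G x a b d = G x d b a) :
    (∀ X Y Z : VF n, SmoothVF X → SmoothVF Y → SmoothVF Z →
        ∀ x, nabG g G X Y Z x = nabG g G Y X Z x) ↔ ∀ x a b e, CC g G x a b e = 0 := by
  constructor
  · intro h x a b e
    have hs : ∀ a : Fin n, SmoothVF (fun _ : Base n => (Pi.single a (1:ℝ) : Fin n → ℝ)) :=
      fun a b => contDiff_const
    have h1 := nab_sub hg hgsym htf _ _ _ (hs a) (hs b) (hs e) x
    rw [h _ _ _ (hs a) (hs b) (hs e) x] at h1
    simpa [Pi.single_apply] using h1.symm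
  · intro h X Y Z hX hY hZ x
    have h1 := nab_sub hg hgsym htf _ _ _ hX hY hZ x
    simp only [h, mul_zero, Finset.sum_const_zero] at h1
    linarith

end Aux15

/-- Let `K` be a torsion-free linear connection (symmetric
Christoffel symbols `G`) on a manifold `E` and `g` a pseudo-Riemannian metric.
Then the following are equivalent: (1) `∇g` is a totally symmetric (0,3)-tensor
field; (2) the 2-form `Υ[g,K]` on `TE` is closed; (3) the Schouten bracket
`[Λ[g,K], Λ[g,K]]` vanishes. -/
theorem stmt15 (n : ℕ) (g ginv : Base n → Fin n → Fin n → ℝ)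
    (G : Base n → Fin n → Fin n → Fin n → ℝ)
    (hg : ∀ a b, ContDiff ℝ (⊤ : ℕ∞) (fun x => g x a b))
    (hginv : ∀ a b, ContDiff ℝ (⊤ : ℕ∞) (fun x => ginv x a b))
    (hgsym : ∀ x a b, g x a b = g x b a)
    (hinv : ∀ x a b, ∑ c, ginv x a c * g x c b = if a = b then (1:ℝ) else 0)
    (hinv' : ∀ x a b, ∑ c, g x a c * ginv x c b = if a = b then (1:ℝ) else 0)
    (hG : ∀ a b d, ContDiff ℝ (⊤ : ℕ∞) (fun x => G x a b d))
    (htf : ∀ x a b d, G x a b d = G x d b a) :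
    ((∀ X Y Z : VF n, SmoothVF X → SmoothVF Y → SmoothVF Z →
        ∀ x, nabG g G X Y Z x = nabG g G Y X Z x)
      ↔ (∀ p (v : Fin 3 → TE n), extd (UpsG g (linK G)) p v = 0))
    ∧ ((∀ p (v : Fin 3 → TE n), extd (UpsG g (linK G)) p v = 0)
        ↔ (∀ p (A B C : Idx n), SB (Lam ginv (linK G)) p A B C = 0)) := by
  have e1 := Aux15.ext_iff hg hG
  have e2 := Aux15.T_iff hg hgsym hG
  have e3 := Aux15.nab_iff (G := G) hg hgsym htf
  refine ⟨e3.trans (e2.symm.trans e1.symm), e1.trans ?_⟩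
  exact forall_congr' fun p => Aux15.SB_iff hg hginv hinv hinv' hG p
end
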